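/- Let X be a nonempty finite set equipped with a metric d, Y a nonempty finite set, and (μ,K) an admissible pair. For probability distributions ν, μ on X, let W₁(ν,μ) = inf Σ_{x,x'} π(x,x')·d(x,x'), the infimum over probability distributions π on X×X whose first marginal is ν and second marginal is μ; for f : X → ℝ let δ(f) = max_{x ≠ x'} |f(x) − f(x')|/d(x,x'). Suppose μ satisfies the information-transportation inequality W₁(ν,μ) ≤ √(2c·D(ν‖μ)) for all distributions ν on X, for some c > 0. Then η(μ,K) ≤ 2c Σ_y (μK)(y)·δ(a(·,y))², where a(x,y) = K*(x|y)/μ(x) is the posterior likelihood ratio. -/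

import Mathlib

open Finset

noncomputable section

namespace SDPI

variable {X Y : Type} [Fintype X] [Fintype Y]

def IsDist (μ : X → ℝ) : Prop := (∀ x, 0 ≤ μ x) ∧ ∑ x, μ x = 1

def IsPosDist (μ : X → ℝ) : Prop := (∀ x, 0 < μ x) ∧ ∑ x, μ x = 1

def IsChannel (K : X → Y → ℝ) : Prop :=
  (∀ x y, 0 ≤ K x y) ∧ ∀ x, ∑ y, K x y = 1

def push (μ : X → ℝ) (K : X → Y → ℝ) : Y → ℝ := fun y => ∑ x, μ x * K x y

def fDiv (Φ : ℝ → ℝ) (ν μ : X → ℝ) : ℝ := (∑ x, μ x * Φ (ν x / μ x)) - Φ 1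

def eta (Φ : ℝ → ℝ) (μ : X → ℝ) (K : X → Y → ℝ) : ℝ :=
  sSup { r | ∃ ν : X → ℝ, IsDist ν ∧ ν ≠ μ ∧
    r = fDiv Φ (push ν K) (push μ K) / fDiv Φ ν μ }

def etaSup (Φ : ℝ → ℝ) (K : X → Y → ℝ) : ℝ :=
  sSup { r | ∃ μ : X → ℝ, IsPosDist μ ∧ r = eta Φ μ K }

def maxCorr (μ : X → ℝ) (K : X → Y → ℝ) : ℝ :=
  sSup { r | ∃ (f : X → ℝ) (g : Y → ℝ),
    (∑ x, μ x * f x) = 0 ∧ (∑ y, push μ K y * g y) = 0 ∧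
    (∑ x, μ x * (f x) ^ 2) = 1 ∧ (∑ y, push μ K y * (g y) ^ 2) = 1 ∧
    r = ∑ x, ∑ y, μ x * K x y * (f x * g y) }

def adjoint (μ : X → ℝ) (K : X → Y → ℝ) : Y → X → ℝ :=
  fun y x => K x y * μ x / push μ K y

def Ent (Φ : ℝ → ℝ) (μ : X → ℝ) (f : X → ℝ) : ℝ :=
  (∑ x, μ x * Φ (f x)) - Φ (∑ x, μ x * f x)

def Var (μ : X → ℝ) (f : X → ℝ) : ℝ :=
  ∑ x, μ x * (f x - ∑ x', μ x' * f x') ^ 2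

def condExp (μ : X → ℝ) (K : X → Y → ℝ) (f : X → ℝ) : Y → ℝ :=
  fun y => (∑ x, μ x * K x y * f x) / push μ K y

def calE (μ : X → ℝ) (K : X → Y → ℝ) (f g : X → ℝ) : ℝ :=
  ∑ x, ∑ y, μ x * K x y *
    ((f x - condExp μ K f y) * (g x - condExp μ K g y))

def dirichlet (μ : X → ℝ) (M : X → X → ℝ) (f g : X → ℝ) : ℝ :=
  (1 / 2) * ∑ x, ∑ x', μ x * M x x' * ((f x - f x') * (g x - g x'))

def Homogeneous (Φ : ℝ → ℝ) : Prop :=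
  ∃ κ : ℝ → ℝ, (∀ c : ℝ, 0 < c → 0 < κ c) ∧
    ∀ (c : ℝ), 0 < c → ∀ (Z : Type) [Fintype Z], ∀ (μ : Z → ℝ),
      IsDist μ → ∀ f : Z → ℝ, (∀ z, 0 ≤ f z) →
        Ent Φ μ (fun z => c * f z) = κ c * Ent Φ μ f

def Subadditive (Φ : ℝ → ℝ) : Prop :=
  ∀ (n : ℕ) (Z : Fin n → Type) [∀ i, Fintype (Z i)],
    ∀ (μ : ∀ i, Z i → ℝ), (∀ i, IsDist (μ i)) →
    ∀ f : (∀ i, Z i) → ℝ, (∀ z, 0 ≤ f z) →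
      Ent Φ (fun z : ∀ i, Z i => ∏ i, μ i (z i)) f ≤
        ∑ i : Fin n,
          ((∑ z : ∀ j, Z j, (∏ j, μ j (z j)) * Φ (f z)) -
            ∑ z : ∀ j, Z j, (∏ j, μ j (z j)) *
              Φ (∑ w : Z i, μ i w * f (Function.update z i w)))


def W1 {X : Type} [Fintype X] [MetricSpace X] (ν μ : X → ℝ) : ℝ :=
  sInf { r | ∃ π : X → X → ℝ, (∀ x x', 0 ≤ π x x') ∧
    (∀ x, ∑ x', π x x' = ν x) ∧ (∀ x', ∑ x, π x x' = μ x') ∧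
    r = ∑ x, ∑ x', π x x' * dist x x' }

def lipNorm {X : Type} [Fintype X] [MetricSpace X] (f : X → ℝ) : ℝ :=
  sSup { r | ∃ x x' : X, x ≠ x' ∧ r = |f x - f x'| / dist x x' }

lemma IsDist.push {ν : X → ℝ} {K : X → Y → ℝ} (hν : IsDist ν) (hK : IsChannel K) :
    IsDist (push ν K) := by
  refine ⟨fun y => Finset.sum_nonneg fun x _ => mul_nonneg (hν.1 x) (hK.1 x y), ?_⟩
  simp only [SDPI.push]
  rw [Finset.sum_comm]
  simp [← Finset.mul_sum, hK.2, hν.2]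

lemma IsPosDist.isDist {μ : X → ℝ} (hμ : IsPosDist μ) : IsDist μ :=
  ⟨fun x => (hμ.1 x).le, hμ.2⟩

lemma fDiv_mul_log_nonneg {ν μ : X → ℝ} (hν : IsDist ν) (hμ : IsPosDist μ) :
    0 ≤ fDiv (fun u => u * Real.log u) ν μ := by
  have h : ∑ x, (ν x - μ x) ≤ ∑ x, μ x * (ν x / μ x * Real.log (ν x / μ x)) := by
    refine Finset.sum_le_sum fun x _ => ?_
    have hx := hμ.1 x
    have hu : ν x / μ x - 1 ≤ ν x / μ x * Real.log (ν x / μ x) := by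
      rcases (div_nonneg (hν.1 x) hx.le).eq_or_lt with h0 | h0
      · rw [← h0]; norm_num
      · have h1 := mul_le_mul_of_nonneg_left (Real.one_sub_inv_le_log_of_pos h0) h0.le
        rwa [mul_sub, mul_one, mul_inv_cancel₀ h0.ne'] at h1
    calc ν x - μ x = μ x * (ν x / μ x - 1) := by field_simp
      _ ≤ _ := mul_le_mul_of_nonneg_left hu hx.le
  rw [Finset.sum_sub_distrib, hν.2, hμ.2] at h
  simpa [fDiv] using h

/-- Relative entropy is bounded by the `χ²`-divergence. -/
lemma fDiv_mul_log_le_chiSq {ν μ : X → ℝ} (hν : IsDist ν) (hμ : IsPosDist μ) :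
    fDiv (fun u => u * Real.log u) ν μ ≤ ∑ x, μ x * (ν x / μ x - 1) ^ 2 := by
  have h : ∑ x, μ x * (ν x / μ x * Real.log (ν x / μ x)) ≤
      ∑ x, (μ x * (ν x / μ x - 1) ^ 2 + (ν x - μ x)) := by
    refine Finset.sum_le_sum fun x _ => ?_
    have hx := hμ.1 x
    have hu : ν x / μ x * Real.log (ν x / μ x) ≤ ν x / μ x * (ν x / μ x - 1) := by
      rcases (div_nonneg (hν.1 x) hx.le).eq_or_lt with h0 | h0
      · rw [← h0]; norm_num
      · exact mul_le_mul_of_nonneg_left (Real.log_le_sub_one_of_pos h0) h0.le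
    calc _ ≤ μ x * (ν x / μ x * (ν x / μ x - 1)) := mul_le_mul_of_nonneg_left hu hx.le
      _ = _ := by field_simp; ring
  rw [Finset.sum_add_distrib, Finset.sum_sub_distrib, hν.2, hμ.2] at h
  simpa [fDiv] using h

section Transport

variable {X : Type} [Fintype X] [MetricSpace X]

lemma lipNorm_nonneg (f : X → ℝ) : 0 ≤ lipNorm f := by
  refine Real.sSup_nonneg ?_
  rintro _ ⟨x, x', -, rfl⟩
  positivity

lemma abs_sub_le_lipNorm_mul_dist (f : X → ℝ) (x x' : X) :
    |f x - f x'| ≤ lipNorm f * dist x x' := by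
  rcases eq_or_ne x x' with rfl | hne
  · simp
  rw [← div_le_iff₀ (dist_pos.2 hne)]
  refine le_csSup (Set.Finite.bddAbove ?_) ⟨x, x', hne, rfl⟩
  refine (Set.finite_range fun p : X × X => |f p.1 - f p.2| / dist p.1 p.2).subset ?_
  rintro _ ⟨a, b, -, rfl⟩
  exact ⟨(a, b), rfl⟩

lemma W1_nonneg (ν μ : X → ℝ) : 0 ≤ W1 ν μ := by
  refine Real.sInf_nonneg ?_
  rintro _ ⟨π, hπ, -, -, rfl⟩
  exact Finset.sum_nonneg fun x _ => Finset.sum_nonneg fun x' _ =>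
    mul_nonneg (hπ x x') dist_nonneg

/-- The easy direction of Kantorovich–Rubinstein duality. -/
lemma abs_sum_sub_mul_le_lipNorm_mul_W1 {ν μ : X → ℝ} (hν : IsDist ν) (hμ : IsDist μ)
    (f : X → ℝ) : |∑ x, (ν x - μ x) * f x| ≤ lipNorm f * W1 ν μ := by
  have key : ∀ π : X → X → ℝ, (∀ x x', 0 ≤ π x x') → (∀ x, ∑ x', π x x' = ν x) →
      (∀ x', ∑ x, π x x' = μ x') →
      |∑ x, (ν x - μ x) * f x| ≤ lipNorm f * ∑ x, ∑ x', π x x' * dist x x' := by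
    intro π h0 h1 h2
    have e : ∑ x, (ν x - μ x) * f x = ∑ x, ∑ x', π x x' * (f x - f x') := by
      simp only [sub_mul, mul_sub, Finset.sum_sub_distrib]
      congr 1
      · simp only [← Finset.sum_mul, h1]
      · rw [Finset.sum_comm]
        simp only [← Finset.sum_mul, h2]
    rw [e, Finset.mul_sum]
    refine (Finset.abs_sum_le_sum_abs _ _).trans (Finset.sum_le_sum fun x _ => ?_)
    rw [Finset.mul_sum]
    refine (Finset.abs_sum_le_sum_abs _ _).trans (Finset.sum_le_sum fun x' _ => ?_)
    rw [abs_mul, abs_of_nonneg (h0 x x'), mul_left_comm]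
    exact mul_le_mul_of_nonneg_left (abs_sub_le_lipNorm_mul_dist f x x') (h0 x x')
  have p0 : ∀ x x', 0 ≤ ν x * μ x' := fun x x' => mul_nonneg (hν.1 x) (hμ.1 x')
  have p1 : ∀ x, ∑ x', ν x * μ x' = ν x := fun x => by rw [← Finset.mul_sum, hμ.2, mul_one]
  have p2 : ∀ x', ∑ x, ν x * μ x' = μ x' := fun x' => by rw [← Finset.sum_mul, hν.2, one_mul]
  rcases (lipNorm_nonneg f).eq_or_lt with hL | hL
  · simpa [← hL] using key _ p0 p1 p2
  · rw [← div_le_iff₀' hL]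
    refine le_csInf ⟨_, _, p0, p1, p2, rfl⟩ ?_
    rintro _ ⟨π, h0, h1, h2, rfl⟩
    rw [div_le_iff₀' hL]
    exact key π h0 h1 h2

end Transport

lemma push_div_push_sub_one {X Y : Type} [Fintype X] {ν μ : X → ℝ} {K : X → Y → ℝ} (hμ : IsPosDist μ)
    {y : Y} (hy : 0 < push μ K y) :
    push ν K y / push μ K y - 1 = ∑ x, (ν x - μ x) * (adjoint μ K y x / μ x) := by
  have h : ∀ x, (ν x - μ x) * (adjoint μ K y x / μ x) =
      (ν x * K x y - μ x * K x y) / push μ K y := fun x => by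
    have := (hμ.1 x).ne'
    simp only [adjoint]
    field_simp
  simp only [h, ← Finset.sum_div, Finset.sum_sub_distrib]
  rw [sub_div]
  change _ = push ν K y / push μ K y - push μ K y / push μ K y
  rw [div_self hy.ne']

/-- Theorem: if `μ` satisfies the information-transportation inequality
`W₁(ν,μ) ≤ √(2c·D(ν‖μ))` for all distributions `ν`, then the relative-entropy SDPI
constant satisfies `η(μ,K) ≤ 2c Σ_y (μK)(y) δ(a(·,y))²`, where `a(x,y) = K*(x|y)/μ(x)`
is the posterior likelihood ratio and `δ` is the Lipschitz norm w.r.t. the metric on X. -/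
theorem statement7 {X Y : Type} [Fintype X] [Fintype Y] [Nonempty X] [Nonempty Y]
    [MetricSpace X]
    (μ : X → ℝ) (K : X → Y → ℝ) (hμ : IsPosDist μ) (hK : IsChannel K)
    (hadm : ∀ y, 0 < push μ K y)
    (c : ℝ) (hc : 0 < c)
    (hT1 : ∀ ν : X → ℝ, IsDist ν →
      W1 ν μ ≤ Real.sqrt (2 * c * fDiv (fun u => u * Real.log u) ν μ)) :
    eta (fun u => u * Real.log u) μ K ≤
      2 * c * ∑ y, push μ K y * (lipNorm (fun x => adjoint μ K y x / μ x)) ^ 2 := by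
  have hq : IsPosDist (push μ K) := ⟨hadm, (hμ.isDist.push hK).2⟩
  have hS : 0 ≤ ∑ y, push μ K y * (lipNorm (fun x => adjoint μ K y x / μ x)) ^ 2 :=
    Finset.sum_nonneg fun y _ => mul_nonneg (hadm y).le (sq_nonneg _)
  refine Real.sSup_le ?_ (by positivity)
  rintro _ ⟨ν, hν, -, rfl⟩
  have hD := fDiv_mul_log_nonneg hν hμ
  have hW : W1 ν μ ^ 2 ≤ 2 * c * fDiv (fun u => u * Real.log u) ν μ :=
    (Real.le_sqrt (W1_nonneg ν μ) (by positivity)).1 (hT1 ν hν)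
  refine div_le_of_le_mul₀ hD (by positivity) ?_
  calc fDiv (fun u => u * Real.log u) (push ν K) (push μ K)
      ≤ ∑ y, push μ K y * (push ν K y / push μ K y - 1) ^ 2 :=
        fDiv_mul_log_le_chiSq (hν.push hK) hq
    _ ≤ ∑ y, push μ K y * (lipNorm (fun x => adjoint μ K y x / μ x) * W1 ν μ) ^ 2 := by
        refine Finset.sum_le_sum fun y _ => mul_le_mul_of_nonneg_left ?_ (hadm y).le
        rw [push_div_push_sub_one hμ (hadm y), ← sq_abs]
        exact pow_le_pow_left₀ (abs_nonneg _)
          (abs_sum_sub_mul_le_lipNorm_mul_W1 hν hμ.isDist _) 2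
    _ = (∑ y, push μ K y * (lipNorm (fun x => adjoint μ K y x / μ x)) ^ 2) * W1 ν μ ^ 2 := by
        simp only [mul_pow, ← mul_assoc, Finset.sum_mul]
    _ ≤ (∑ y, push μ K y * (lipNorm (fun x => adjoint μ K y x / μ x)) ^ 2) *
          (2 * c * fDiv (fun u => u * Real.log u) ν μ) := mul_le_mul_of_nonneg_left hW hS
    _ = _ := by ring

end SDPI
end
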